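/- Let n ≥ 1 be an integer, π a permutation of Fin n, and i* ∈ Fin n. Define scores s : Fin (2n+1) → ℝ by s(2k) = cos(2π((i*:ℝ) − (π k:ℝ))/(n+1)) − 1 and s(2k+1) = cos(2π((i*:ℝ) − (π k:ℝ))/(n+1)) for k ∈ Fin n, and s(2n) = 0. Then s attains its maximum value 1 at exactly one position, namely j* = 2·π⁻¹(i*) + 1. -/

import Mathlib

/-- The second-layer attention scores at the final position in the 2-layer construction
of Theorem 10: `s(2k) = cos (2π((i*:ℝ) − (σ k:ℝ))/(n+1)) − 1`,
`s(2k+1) = cos (2π((i*:ℝ) − (σ k:ℝ))/(n+1))`, and `s(2n) = 0`. -/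
noncomputable def layer2Scores (n : ℕ) (σ : Equiv.Perm (Fin n)) (istar : Fin n) :
    Fin (2 * n + 1) → ℝ :=
  fun j =>
    if h : (j : ℕ) < 2 * n then
      if (j : ℕ) % 2 = 0 then
        Real.cos (2 * Real.pi *
          (((istar : ℕ) : ℝ) - ((σ ⟨(j : ℕ) / 2, by omega⟩ : ℕ) : ℝ)) / (n + 1)) - 1
      else
        Real.cos (2 * Real.pi *
          (((istar : ℕ) : ℝ) - ((σ ⟨(j : ℕ) / 2, by omega⟩ : ℕ) : ℝ)) / (n + 1))
    else 0

theorem cos_two_pi_mul_sub_div_lt_one {n a b : ℕ} (ha : a < n) (hb : b < n) (hab : a ≠ b) :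
    Real.cos (2 * Real.pi * ((a : ℝ) - (b : ℝ)) / (n + 1)) < 1 := by
  have hn : (0 : ℝ) < n + 1 := by positivity
  have ha' : (a : ℝ) < n := by exact_mod_cast ha
  have hb' : (b : ℝ) < n := by exact_mod_cast hb
  have ha₀ : (0 : ℝ) ≤ a := a.cast_nonneg
  have hb₀ : (0 : ℝ) ≤ b := b.cast_nonneg
  have hpi := Real.two_pi_pos
  refine lt_of_le_of_ne (Real.cos_le_one _) fun h => ?_
  rw [Real.cos_eq_one_iff_of_lt_of_lt] at h
  · have hsub : (a : ℝ) - b ≠ 0 := sub_ne_zero.mpr (by exact_mod_cast hab)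
    exact div_ne_zero (mul_ne_zero hpi.ne' hsub) hn.ne' h
  · rw [lt_div_iff₀ hn]
    nlinarith
  · rw [div_lt_iff₀ hn]
    nlinarith

/-- Let `n ≥ 1`, `σ` a permutation of `Fin n`, and `i* ∈ Fin n`.  The
scores `layer2Scores n σ i*` attain their maximum value `1` at exactly one position,
namely `j* = 2·σ⁻¹(i*) + 1`. -/
theorem layer2_unique_maximizer (n : ℕ) (hn : 1 ≤ n)
    (σ : Equiv.Perm (Fin n)) (istar : Fin n) :
    layer2Scores n σ istar
        (⟨2 * ((σ.symm istar : Fin n) : ℕ) + 1, by have := (σ.symm istar).isLt; omega⟩ :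
          Fin (2 * n + 1)) = 1
    ∧ ∀ j : Fin (2 * n + 1),
        j ≠ (⟨2 * ((σ.symm istar : Fin n) : ℕ) + 1, by have := (σ.symm istar).isLt; omega⟩ :
              Fin (2 * n + 1)) →
        layer2Scores n σ istar j < 1 := by
  constructor
  · have hlt : 2 * ((σ.symm istar : Fin n) : ℕ) + 1 < 2 * n := by
      have := (σ.symm istar).isLt
      omega
    have hdiv : (2 * ((σ.symm istar : Fin n) : ℕ) + 1) / 2 = (σ.symm istar : Fin n) := by omega
    simp [layer2Scores, hlt, hdiv, Nat.add_mod]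
  · intro j hj
    unfold layer2Scores
    split_ifs with h hpar
    · linarith [Real.cos_le_one (2 * Real.pi *
        (((istar : ℕ) : ℝ) - ((σ ⟨(j : ℕ) / 2, by omega⟩ : ℕ) : ℝ)) / (n + 1))]
    · refine cos_two_pi_mul_sub_div_lt_one istar.isLt (Fin.isLt _) fun heq => hj ?_
      have hk : σ.symm istar = ⟨(j : ℕ) / 2, by omega⟩ := by
        rw [Equiv.symm_apply_eq]
        exact Fin.ext heq
      ext
      simp only [hk]
      omega
    · exact one_pos
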